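/- Let {△̄, A} be a poised interpolation problem on a strip of n triangles, and for 1 ≤ k ≤ m ≤ n let νₖᵐ = #(A ∩ |△̄ₖᵐ|). Then m−k−1 ≤ νₖᵐ ≤ m−k+3 for all 1 ≤ k ≤ m ≤ n; moreover, m ≤ ν₁ᵐ ≤ m+2 for all 1 ≤ m ≤ n, and n−k+1 ≤ νₖⁿ ≤ n−k+3 for all 1 ≤ k ≤ n. -/

import Mathlib

open scoped Classical

noncomputable section

/-- Points of the plane. -/
abbrev E : Type := ℝ × ℝ

/-- The closed triangle `Δᵢ` with vertices `V i`, `V (i+1)`, `V (i+2)`. -/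
def tri (V : ℕ → E) (i : ℕ) : Set E :=
  convexHull ℝ {V i, V (i + 1), V (i + 2)}

/-- `V 1, …, V (n+2)` are the vertices of a strip of `n` triangles
`Δ₁, …, Δₙ`, where `Δᵢ = [Vᵢ, Vᵢ₊₁, Vᵢ₊₂]`. -/
structure IsStrip (n : ℕ) (V : ℕ → E) : Prop where
  indep : ∀ i, 1 ≤ i → i ≤ n → AffineIndependent ℝ ![V i, V (i + 1), V (i + 2)]
  adj : ∀ i, 1 ≤ i → i + 1 ≤ n →
    tri V i ∩ tri V (i + 1) = segment ℝ (V (i + 1)) (V (i + 2))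
  touch : ∀ i, 1 ≤ i → i + 2 ≤ n → tri V i ∩ tri V (i + 2) = {V (i + 2)}
  disj : ∀ i j, 1 ≤ i → j ≤ n → i + 3 ≤ j → tri V i ∩ tri V j = ∅

/-- The underlying set `|△̄ₖᵐ|` of the (sub)strip consisting of the triangles
`Δ k, …, Δ m`. -/
def stripSet (V : ℕ → E) (k m : ℕ) : Set E :=
  ⋃ i ∈ Finset.Icc k m, tri V i

/-- The space `S(△̄ₖᵐ)` of continuous functions on the strip `|△̄ₖᵐ|` whose
restriction to each triangle `Δᵢ`, `k ≤ i ≤ m`, agrees with an affine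
function `ℝ² → ℝ`. -/
def stripSpace (V : ℕ → E) (k m : ℕ) : Submodule ℝ (stripSet V k m → ℝ) where
  carrier := {s | Continuous s ∧ ∀ i ∈ Finset.Icc k m, ∃ f : E →ᵃ[ℝ] ℝ,
    ∀ x : stripSet V k m, (x : E) ∈ tri V i → s x = f x}
  add_mem' := by
    rintro a b ⟨hca, ha⟩ ⟨hcb, hb⟩
    refine ⟨hca.add hcb, fun i hi => ?_⟩
    obtain ⟨f, hf⟩ := ha i hi
    obtain ⟨g, hg⟩ := hb i hi
    exact ⟨f + g, fun x hx => by simp [hf x hx, hg x hx]⟩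
  zero_mem' := ⟨continuous_const, fun i hi => ⟨0, fun x hx => by simp⟩⟩
  smul_mem' := by
    rintro c a ⟨hca, ha⟩
    refine ⟨hca.const_smul c, fun i hi => ?_⟩
    obtain ⟨f, hf⟩ := ha i hi
    exact ⟨c • f, fun x hx => by simp [hf x hx]⟩

/-- Poisedness of a node set `A` for a subspace `T` of the functions on the
strip `|△̄ₖᵐ|`: for every data `c` there is a unique `s ∈ T` interpolating
`c` at the nodes. -/
def PoisedFor (V : ℕ → E) (k m : ℕ) (T : Submodule ℝ (stripSet V k m → ℝ))
    (A : Finset E) : Prop :=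
  ∀ c : E → ℝ, ∃! s : stripSet V k m → ℝ,
    s ∈ T ∧ ∀ a : stripSet V k m, (a : E) ∈ A → s a = c a

/-- Poisedness of the interpolation problem `{△̄ₖᵐ, A}`. -/
def Poised (V : ℕ → E) (k m : ℕ) (A : Finset E) : Prop :=
  PoisedFor V k m (stripSpace V k m) A

/-- The node set `Aₖᵐ = A ∩ |△̄ₖᵐ|` of the subproblem `{△̄, A}ₖᵐ`. -/
def nodesIn (V : ℕ → E) (k m : ℕ) (A : Finset E) : Finset E :=
  A.filter (fun x => x ∈ stripSet V k m)

/-- The nodes of `A` lying in the triangle `Δᵢ`. -/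
def triNodes (V : ℕ → E) (i : ℕ) (A : Finset E) : Finset E :=
  A.filter (fun x => x ∈ tri V i)

/-- An affinely independent triple in the plane admits an affine function with prescribed values. -/
lemma exists_affineMap_of_affineIndependent {p : Fin 3 → E} (hp : AffineIndependent ℝ p)
    (y : Fin 3 → ℝ) : ∃ f : E →ᵃ[ℝ] ℝ, ∀ j, f (p j) = y j := by
  have hspan : affineSpan ℝ (Set.range p) = ⊤ :=
    hp.affineSpan_eq_top_iff_card_eq_finrank_add_one.2 (by simp)
  let b : AffineBasis (Fin 3) ℝ E := ⟨p, hp, hspan⟩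
  refine ⟨∑ i, y i • b.coord i, fun j => ?_⟩
  have hb : ∀ i, b.coord i (p j) = if i = j then 1 else 0 := fun i => b.coord_apply i j
  have hsum : (∑ i, y i • b.coord i) (p j) = ∑ i, y i * b.coord i (p j) := by
    simp [Fin.sum_univ_three]
  rw [hsum]
  simp [hb]

lemma vertex_mem_tri (V : ℕ → E) {i j : ℕ} (hij : i ≤ j) (hji : j ≤ i + 2) : V j ∈ tri V i := by
  apply subset_convexHull
  obtain rfl | rfl | rfl : j = i ∨ j = i + 1 ∨ j = i + 2 := by omega
  all_goals simp

lemma tri_subset_stripSet (V : ℕ → E) {i k m : ℕ} (hk : k ≤ i) (hm : i ≤ m) :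
    tri V i ⊆ stripSet V k m :=
  Set.subset_biUnion_of_mem (u := fun i => tri V i) (Finset.mem_Icc.2 ⟨hk, hm⟩)

lemma mem_stripSet {V : ℕ → E} {k m : ℕ} {x : E} :
    x ∈ stripSet V k m ↔ ∃ i, k ≤ i ∧ i ≤ m ∧ x ∈ tri V i := by
  simp [stripSet, and_assoc]

lemma isClosed_tri (V : ℕ → E) (i : ℕ) : IsClosed (tri V i) :=
  (Set.toFinite _).isClosed_convexHull ℝ

lemma vertex_mem_stripSet (V : ℕ → E) {n j : ℕ} (hn : 1 ≤ n) (h1 : 1 ≤ j) (hj : j ≤ n + 2) :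
    V j ∈ stripSet V 1 n := by
  rcases le_total j n with h | h
  · exact tri_subset_stripSet V h1 h (vertex_mem_tri V le_rfl (by omega))
  · exact tri_subset_stripSet V hn le_rfl (vertex_mem_tri V h hj)

lemma AffineMap.eqOn_segment {f g : E →ᵃ[ℝ] ℝ} {a b : E} (ha : f a = g a) (hb : f b = g b) :
    Set.EqOn f g (segment ℝ a b) := by
  intro x hx
  rw [segment_eq_image_lineMap] at hx
  obtain ⟨t, -, rfl⟩ := hx
  simp only [AffineMap.apply_lineMap, ha, hb]

/-- A function of the spline space with prescribed values at the vertices of the strip. -/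
lemma exists_mem_stripSpace {n : ℕ} {V : ℕ → E} (hV : IsStrip n V) (y : ℕ → ℝ) :
    ∃ s ∈ stripSpace V 1 n, ∀ j (x : stripSet V 1 n), 1 ≤ j → j ≤ n + 2 → (x : E) = V j →
      1 ≤ n → s x = y j := by
  have key : ∀ i, ∃ f : E →ᵃ[ℝ] ℝ, 1 ≤ i → i ≤ n → ∀ j, i ≤ j → j ≤ i + 2 → f (V j) = y j := by
    intro i
    by_cases hi : 1 ≤ i ∧ i ≤ n
    · obtain ⟨f, hf⟩ := exists_affineMap_of_affineIndependent (hV.indep i hi.1 hi.2)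
        ![y i, y (i + 1), y (i + 2)]
      refine ⟨f, fun _ _ j h1 h2 => ?_⟩
      obtain rfl | rfl | rfl : j = i ∨ j = i + 1 ∨ j = i + 2 := by omega
      · simpa using hf 0
      · simpa using hf 1
      · simpa using hf 2
    · exact ⟨0, fun h1 h2 => absurd ⟨h1, h2⟩ hi⟩
  choose f hf using key
  have compat : ∀ i j, 1 ≤ i → i < j → j ≤ n → ∀ x ∈ tri V i ∩ tri V j, f i x = f j x := by
    intro i j hi hij hj x hx
    obtain rfl | rfl | h3 : j = i + 1 ∨ j = i + 2 ∨ i + 3 ≤ j := by omega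
    · rw [hV.adj i hi hj] at hx
      refine AffineMap.eqOn_segment ?_ ?_ hx
      all_goals rw [hf i hi (by omega) _ (by omega) (by omega),
        hf (i + 1) (by omega) hj _ (by omega) (by omega)]
    · rw [hV.touch i hi hj, Set.mem_singleton_iff] at hx
      rw [hx, hf i hi (by omega) _ (by omega) (by omega),
        hf (i + 2) (by omega) hj _ (by omega) (by omega)]
    · rw [hV.disj i j hi hj h3] at hx
      exact hx.elim
  have hmem : ∀ x : stripSet V 1 n, ∃ i, 1 ≤ i ∧ i ≤ n ∧ (x : E) ∈ tri V i :=
    fun x => mem_stripSet.1 x.2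
  choose ι hι1 hιn hι using hmem
  let s : stripSet V 1 n → ℝ := fun x => f (ι x) x
  have hs : ∀ i, 1 ≤ i → i ≤ n → ∀ x : stripSet V 1 n, (x : E) ∈ tri V i → s x = f i x := by
    intro i hi hin x hx
    rcases lt_trichotomy (ι x) i with h | h | h
    · exact compat _ _ (hι1 x) h hin x ⟨hι x, hx⟩
    · simp only [s, h]
    · exact (compat _ _ hi h (hιn x) x ⟨hx, hι x⟩).symm
  refine ⟨s, ⟨?_, fun i hi => ?_⟩, ?_⟩
  · refine (locallyFinite_of_finite
      (fun i : Finset.Icc 1 n => {x : stripSet V 1 n | (x : E) ∈ tri V i})).continuous ?_ ?_ ?_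
    · refine Set.eq_univ_of_forall fun x => Set.mem_iUnion.2 ?_
      exact ⟨⟨ι x, Finset.mem_Icc.2 ⟨hι1 x, hιn x⟩⟩, hι x⟩
    · exact fun i => (isClosed_tri V i).preimage continuous_subtype_val
    · intro i
      have hi := Finset.mem_Icc.1 i.2
      have hc : Continuous fun x : stripSet V 1 n => f i x :=
        (f i).continuous_of_finiteDimensional.comp continuous_subtype_val
      exact hc.continuousOn.congr fun x hx => hs i hi.1 hi.2 x hx
  · have hi := Finset.mem_Icc.1 hi
    exact ⟨f i, hs i hi.1 hi.2⟩
  · intro j x h1 h2 hx hn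
    rcases le_total j n with h | h
    · rw [hs j h1 h x (hx ▸ vertex_mem_tri V le_rfl (by omega)), hx]
      exact hf j h1 h j le_rfl (by omega)
    · rw [hs n hn le_rfl x (hx ▸ vertex_mem_tri V h h2), hx]
      exact hf n hn le_rfl j h h2

/-- A poised node set has at least as many elements as the strip has vertices. -/
lemma Poised.le_card {n : ℕ} (hn : 1 ≤ n) {V : ℕ → E} (hV : IsStrip n V) {A : Finset E}
    (hA : ↑A ⊆ stripSet V 1 n) (hp : Poised V 1 n A) : n + 2 ≤ A.card := by
  let Φ : stripSpace V 1 n →ₗ[ℝ] (A → ℝ) :=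
    (LinearMap.funLeft ℝ ℝ (fun a : A => (⟨a, hA a.2⟩ : stripSet V 1 n))).comp
      (stripSpace V 1 n).subtype
  let Ψ : stripSpace V 1 n →ₗ[ℝ] (Fin (n + 2) → ℝ) :=
    (LinearMap.funLeft ℝ ℝ (fun j : Fin (n + 2) => (⟨V (j + 1),
      vertex_mem_stripSet V hn (by omega) (by omega)⟩ : stripSet V 1 n))).comp
      (stripSpace V 1 n).subtype
  have hΦ : Function.Injective Φ := by
    rw [← LinearMap.ker_eq_bot, LinearMap.ker_eq_bot']
    intro s hs
    refine Subtype.ext ((hp 0).unique ⟨s.2, fun a ha => ?_⟩ ⟨Submodule.zero_mem _, fun _ _ => rfl⟩)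
    exact congrFun hs ⟨a, ha⟩
  have hΨ : Function.Surjective Ψ := by
    intro y
    obtain ⟨s, hs, h⟩ := exists_mem_stripSpace hV
      (fun j => if h : j - 1 < n + 2 then y ⟨j - 1, h⟩ else 0)
    refine ⟨⟨s, hs⟩, funext fun j => ?_⟩
    have := h (j + 1) ⟨V (j + 1), vertex_mem_stripSet V hn (by omega) (by omega)⟩
      (by omega) (by omega) rfl hn
    simpa [Ψ, LinearMap.funLeft_apply] using this
  have : FiniteDimensional ℝ (stripSpace V 1 n) := FiniteDimensional.of_injective Φ hΦ
  have h1 := LinearMap.finrank_le_finrank_of_injective hΦ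
  have h2 := LinearMap.finrank_le_finrank_of_surjective hΨ
  simp only [Module.finrank_fintype_fun_eq_card, Fintype.card_fin, Fintype.card_coe] at h1 h2
  exact h2.trans h1

/-- The nodes of a poised problem lying in a substrip are at most as many as its vertices. -/
lemma Poised.card_nodesIn_le {n : ℕ} {V : ℕ → E} {A : Finset E} (hp : Poised V 1 n A) {k m : ℕ}
    (hk : 1 ≤ k) (hkm : k ≤ m) (hm : m ≤ n) : (nodesIn V k m A).card ≤ m - k + 3 := by
  have hsub : stripSet V k m ⊆ stripSet V 1 n := by
    intro x hx
    obtain ⟨i, h1, h2, h⟩ := mem_stripSet.1 hx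
    exact mem_stripSet.2 ⟨i, by omega, by omega, h⟩
  have hv : ∀ j : Fin (m - k + 3), V (k + j) ∈ stripSet V 1 n := fun j =>
    vertex_mem_stripSet V (by omega) (by omega) (by omega)
  let B := nodesIn V k m A
  have hB : ∀ a : B, (a : E) ∈ A ∧ (a : E) ∈ stripSet V k m := fun a => by
    simpa [B, nodesIn] using a.2
  let S := stripSpace V 1 n
  let Φ : S →ₗ[ℝ] (B → ℝ) :=
    (LinearMap.funLeft ℝ ℝ (fun a : B => (⟨a, hsub (hB a).2⟩ : stripSet V 1 n))).comp S.subtype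
  let Ψ : S →ₗ[ℝ] (Fin (m - k + 3) → ℝ) :=
    (LinearMap.funLeft ℝ ℝ (fun j : Fin (m - k + 3) => (⟨V (k + j), hv j⟩ : stripSet V 1 n))).comp S.subtype
  have hΦ : Function.Surjective Φ := by
    intro y
    obtain ⟨s, ⟨hs, h⟩, -⟩ := hp (fun x => if h : x ∈ B then y ⟨x, h⟩ else 0)
    refine ⟨⟨s, hs⟩, funext fun a => ?_⟩
    have := h ⟨a, hsub (hB a).2⟩ (hB a).1
    simpa [Φ, LinearMap.funLeft_apply] using this
  have hker : LinearMap.ker Ψ ≤ LinearMap.ker Φ := by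
    intro s hs
    refine LinearMap.mem_ker.2 (funext fun a => ?_)
    obtain ⟨i, h1, h2, hi⟩ := mem_stripSet.1 (hB a).2
    obtain ⟨f, hf⟩ := s.2.2 i (Finset.mem_Icc.2 ⟨by omega, by omega⟩)
    have hz : ∀ j, i ≤ j → j ≤ i + 2 → f (V j) = 0 := by
      intro j hij hji
      have h0 := congrFun (LinearMap.mem_ker.1 hs) ⟨j - k, by omega⟩
      have hkj : k + (j - k) = j := by omega
      have h0' : s.1 ⟨V (k + (j - k)), hv ⟨j - k, by omega⟩⟩ = 0 := h0
      rw [hf _ (vertex_mem_tri V (hij.trans_eq hkj.symm) (hkj.trans_le hji))] at h0'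
      simpa only [hkj] using h0'
    have htri : tri V i ⊆ f ⁻¹' {0} := by
      refine convexHull_min ?_ ((convex_singleton (0 : ℝ)).affine_preimage f)
      rintro x (rfl | rfl | rfl)
      · exact hz _ le_rfl (by omega)
      · exact hz _ (by omega) (by omega)
      · exact hz _ (by omega) le_rfl
    exact (hf ⟨a, hsub (hB a).2⟩ hi).trans (htri hi)
  obtain ⟨r, hr⟩ := Φ.exists_rightInverse_of_surjective (LinearMap.range_eq_top.2 hΦ)
  have hinj : Function.Injective (Ψ ∘ₗ r) := by
    rw [← LinearMap.ker_eq_bot, LinearMap.ker_eq_bot']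
    intro y hy
    have : Φ (r y) = 0 := hker hy
    rwa [← LinearMap.comp_apply, hr] at this
  have h := LinearMap.finrank_le_finrank_of_injective hinj
  simpa [B] using h

lemma nodesIn_eq_empty (V : ℕ → E) {k m : ℕ} (h : m < k) (A : Finset E) : nodesIn V k m A = ∅ := by
  simp [nodesIn, stripSet, Finset.Icc_eq_empty_of_lt h]

lemma card_le_card_nodesIn_add {n : ℕ} {V : ℕ → E} {A : Finset E} (hA : ↑A ⊆ stripSet V 1 n)
    (k m : ℕ) : A.card ≤ (nodesIn V 1 (k - 1) A).card + (nodesIn V k m A).card +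
      (nodesIn V (m + 1) n A).card := by
  have hsub : A ⊆ nodesIn V 1 (k - 1) A ∪ nodesIn V k m A ∪ nodesIn V (m + 1) n A := by
    intro a ha
    obtain ⟨i, h1, hn, hi⟩ := mem_stripSet.1 (hA ha)
    simp only [nodesIn, Finset.mem_union, Finset.mem_filter, ha, true_and, mem_stripSet]
    rcases lt_or_ge i k with h | h
    · exact Or.inl (Or.inl ⟨i, h1, by omega, hi⟩)
    rcases le_or_gt i m with h' | h'
    · exact Or.inl (Or.inr ⟨i, h, h', hi⟩)
    · exact Or.inr ⟨i, h', hn, hi⟩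
  calc A.card ≤ _ := Finset.card_le_card hsub
    _ ≤ _ := Finset.card_union_le _ _
    _ ≤ _ := Nat.add_le_add_right (Finset.card_union_le _ _) _

/-- necessary conditions for poisedness: if `{△̄, A}` is poised
and `νₖᵐ = #(A ∩ |△̄ₖᵐ|)`, then `m - k - 1 ≤ νₖᵐ ≤ m - k + 3`; moreover
`m ≤ ν₁ᵐ ≤ m + 2` and `n - k + 1 ≤ νₖⁿ ≤ n - k + 3`. -/
theorem necessary_counts (n : ℕ) (hn : 1 ≤ n) (V : ℕ → E)
    (hV : IsStrip n V) (A : Finset E) (hA : ↑A ⊆ stripSet V 1 n)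
    (hp : Poised V 1 n A) :
    (∀ k m, 1 ≤ k → k ≤ m → m ≤ n →
      m - k - 1 ≤ (nodesIn V k m A).card ∧
      (nodesIn V k m A).card ≤ m - k + 3) ∧
    (∀ m, 1 ≤ m → m ≤ n →
      m ≤ (nodesIn V 1 m A).card ∧ (nodesIn V 1 m A).card ≤ m + 2) ∧
    (∀ k, 1 ≤ k → k ≤ n →
      n - k + 1 ≤ (nodesIn V k n A).card ∧
      (nodesIn V k n A).card ≤ n - k + 3) := by
  have hcard := hp.le_card hn hV hA
  have upper : ∀ k m, 1 ≤ k → k ≤ m → m ≤ n → (nodesIn V k m A).card ≤ m - k + 3 :=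
    fun k m hk hkm hm => hp.card_nodesIn_le hk hkm hm
  have left : ∀ k, 1 ≤ k → k ≤ n → (nodesIn V 1 (k - 1) A).card ≤ k + 1 ∧
      (k = 1 → (nodesIn V 1 (k - 1) A).card = 0) := by
    intro k hk hkn
    rcases hk.eq_or_lt with rfl | h
    · simp [nodesIn_eq_empty]
    · have := upper 1 (k - 1) le_rfl (by omega) (by omega)
      exact ⟨by omega, by omega⟩
  have right : ∀ m, m ≤ n → (nodesIn V (m + 1) n A).card ≤ n - m + 2 ∧
      (m = n → (nodesIn V (m + 1) n A).card = 0) := by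
    intro m hm
    rcases hm.eq_or_lt with rfl | h
    · simp [nodesIn_eq_empty]
    · have := upper (m + 1) n (by omega) (by omega) le_rfl
      exact ⟨by omega, by omega⟩
  refine ⟨fun k m hk hkm hm => ⟨?_, upper k m hk hkm hm⟩, fun m hm hmn => ⟨?_, ?_⟩,
    fun k hk hkn => ⟨?_, upper k n hk hkn le_rfl⟩⟩
  · have := card_le_card_nodesIn_add hA k m
    have := (left k hk (by omega)).1
    have := (right m hm).1
    omega
  · have := card_le_card_nodesIn_add hA 1 m
    have := (left 1 le_rfl hn).2 rfl
    have := (right m hmn).1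
    omega
  · have := upper 1 m le_rfl hm hmn
    omega
  · have := card_le_card_nodesIn_add hA k n
    have := (left k hk hkn).1
    have := (right n le_rfl).2 rfl
    omega
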